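/- Let p be a prime, A a commutative ring, I ⊆ A a finitely generated ideal, and r ≥ 1. Then for every N ≥ 1 there exists M ≥ 1 such that W_r(I^M) ⊆ W_r(I)^N as ideals of W_r(A). -/

import Mathlib

open Function

/-- The functorial ring homomorphism `W_r(A) → W_r(B)` induced by a ring homomorphism
`f : A → B`, obtained by descending `W(A) → W(B) → W_r(B)` along the surjection
`W(A) → W_r(A)` (with the canonical set-theoretic section). -/
noncomputable def wittMap (p r : ℕ) [hp : Fact p.Prime] {A B : Type*} [CommRing A] [CommRing B]
    (f : A →+* B) : TruncatedWittVector p r A →+* TruncatedWittVector p r B :=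
  (WittVector.truncate r).liftOfRightInverse TruncatedWittVector.out
    (fun x => TruncatedWittVector.truncateFun_out x)
    ⟨(WittVector.truncate r).comp (WittVector.map f), fun x hx => by
      rw [RingHom.mem_ker, RingHom.comp_apply, ← RingHom.mem_ker,
        WittVector.mem_ker_truncate]
      intro i hi
      rw [WittVector.map_coeff, (WittVector.mem_ker_truncate r x).mp hx i hi, map_zero]⟩

/-- The ideal `W_r(I) ⊆ W_r(A)`: the kernel of the natural surjection `W_r(A) → W_r(A/I)`. -/
noncomputable def wittIdeal (p r : ℕ) [Fact p.Prime] {A : Type*} [CommRing A] (I : Ideal A) :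
    Ideal (TruncatedWittVector p r A) :=
  RingHom.ker (wittMap p r (Ideal.Quotient.mk I))

namespace WittVector

variable {p : ℕ} [Fact p.Prime]

theorem map_frobenius_apply {R S : Type*} [CommRing R] [CommRing S] (f : R →+* S)
    (x : WittVector p R) : map f (frobenius x) = frobenius (map f x) := by
  ext n
  rw [map_coeff, coeff_frobenius, coeff_frobenius, MvPolynomial.map_aeval,
    funext (map_coeff f x), RingHom.ext_int (f.comp (algebraMap ℤ R)) (algebraMap ℤ S),
    MvPolynomial.aeval_eq_eval₂Hom]

theorem frobenius_teichmuller {R : Type*} [CommRing R] (a : R) :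
    frobenius (teichmuller p a) = teichmuller p (a ^ p) := by
  have hQ : frobenius (teichmuller p (Polynomial.X : Polynomial ℚ)) =
      teichmuller p (Polynomial.X ^ p) := by
    have : Invertible (p : ℚ) :=
      invertibleOfNonzero (Nat.cast_ne_zero.mpr (Fact.out : p.Prime).ne_zero)
    have : Invertible (p : Polynomial ℚ) :=
      (Invertible.map (Polynomial.C : ℚ →+* Polynomial ℚ) (p : ℚ)).copy _ (by simp)
    apply (ghostMap.bijective_of_invertible p (Polynomial ℚ)).injective
    funext n
    rw [ghostMap_apply, ghostMap_apply, ghostComponent_frobenius, ghostComponent_teichmuller,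
      ghostComponent_teichmuller, ← pow_mul, pow_succ']
  have hZ : frobenius (teichmuller p (Polynomial.X : Polynomial ℤ)) =
      teichmuller p (Polynomial.X ^ p) := by
    apply map_injective (Polynomial.mapRingHom (Int.castRingHom ℚ))
      (Polynomial.map_injective _ Int.cast_injective)
    simpa [map_frobenius_apply] using hQ
  simpa [map_frobenius_apply] using
    congrArg (map (Polynomial.eval₂RingHom (Int.castRingHom R) a)) hZ

theorem iterate_frobenius_teichmuller {R : Type*} [CommRing R] (a : R) (k : ℕ) :
    frobenius^[k] (teichmuller p a) = teichmuller p (a ^ p ^ k) := by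
  induction k with
  | zero => simp
  | succ k ih =>
    rw [Function.iterate_succ_apply', ih, frobenius_teichmuller, ← pow_mul, pow_succ]

theorem mem_ker_map_mk {R : Type*} [CommRing R] {J : Ideal R} {x : WittVector p R} :
    x ∈ RingHom.ker (map (p := p) (Ideal.Quotient.mk J)) ↔ ∀ n, x.coeff n ∈ J := by
  simp only [RingHom.mem_ker, map_eq_zero_iff, Ideal.Quotient.eq_zero_iff_mem]

theorem teichmuller_mem_ker_map_mk {R : Type*} [CommRing R] {J : Ideal R} {a : R} (ha : a ∈ J) :
    teichmuller p a ∈ RingHom.ker (map (p := p) (Ideal.Quotient.mk J)) := by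
  rw [RingHom.mem_ker, map_teichmuller, Ideal.Quotient.eq_zero_iff_mem.mpr ha, teichmuller_zero]

theorem truncate_iterate_verschiebung_self {R : Type*} [CommRing R] (r : ℕ)
    (x : WittVector p R) : truncate r (verschiebung^[r] x) = 0 := by
  rw [← RingHom.mem_ker, mem_ker_truncate]
  exact fun i hi => iterate_verschiebung_coeff_eq_zero x hi

end WittVector

section

variable {p r : ℕ} [Fact p.Prime] {A : Type*} [CommRing A]

open WittVector

theorem wittMap_truncate {B : Type*} [CommRing B] (f : A →+* B) (x : WittVector p A) :
    wittMap p r f (truncate r x) = truncate r (map f x) :=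
  RingHom.liftOfRightInverse_comp_apply _ _ _ _ _

theorem truncate_mem_wittIdeal {J : Ideal A} {x : WittVector p A}
    (hx : x ∈ RingHom.ker (map (p := p) (Ideal.Quotient.mk J))) :
    truncate r x ∈ wittIdeal p r J := by
  rw [wittIdeal, RingHom.mem_ker, wittMap_truncate, RingHom.mem_ker.mp hx, map_zero]

theorem exists_truncate_eq_of_mem_wittIdeal {J : Ideal A} {x : TruncatedWittVector p r A}
    (hx : x ∈ wittIdeal p r J) :
    ∃ y ∈ RingHom.ker (map (p := p) (Ideal.Quotient.mk J)), truncate r y = x := by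
  have hxy : truncate r x.out = x := TruncatedWittVector.truncateFun_out x
  refine ⟨x.out, mem_ker_map_mk.mpr fun n => ?_, hxy⟩
  rw [wittIdeal, RingHom.mem_ker, ← hxy, wittMap_truncate, ← RingHom.mem_ker,
    mem_ker_truncate] at hx
  by_cases hn : n < r
  · simpa [Ideal.Quotient.eq_zero_iff_mem] using hx n hn
  · simp [TruncatedWittVector.out, hn]

/-- If `V^k [f c]` lies in `K` modulo `V^r` for all `f` in a set of generators of `J`, all `c` and
all `k < r`, then so does every Witt vector with coefficients in `J`. -/
theorem wittIdeal_span_le {S : Set A} {K : Ideal (TruncatedWittVector p r A)}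
    (hK : ∀ k < r, ∀ f ∈ S, ∀ c, truncate r (verschiebung^[k] (teichmuller p (f * c))) ∈ K) :
    wittIdeal p r (Ideal.span S) ≤ K := by
  have hlead : ∀ k < r, ∀ a ∈ Ideal.span S, ∀ c : A,
      ∃ z ∈ RingHom.ker (map (p := p) (Ideal.Quotient.mk (Ideal.span S))),
        z.coeff 0 = a * c ∧ truncate r (verschiebung^[k] z) ∈ K := by
    intro k hk a ha
    induction ha using Submodule.span_induction with
    | mem f hf =>
      intro c
      exact ⟨teichmuller p (f * c), teichmuller_mem_ker_map_mk
        (Ideal.mul_mem_right _ _ (Ideal.subset_span hf)), teichmuller_coeff_zero _ _,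
        hK k hk f hf c⟩
    | zero =>
      intro c
      exact ⟨0, zero_mem _, by simp, by simp [iterate_map_zero]⟩
    | add a b _ _ iha ihb =>
      intro c
      obtain ⟨y, hy, hya, hyK⟩ := iha c
      obtain ⟨z, hz, hzb, hzK⟩ := ihb c
      refine ⟨y + z, add_mem hy hz, ?_, ?_⟩
      · rw [add_coeff_zero, hya, hzb, add_mul]
      · rw [iterate_map_add, map_add]
        exact add_mem hyK hzK
    | smul b a _ iha =>
      intro c
      obtain ⟨z, hz, hza, hzK⟩ := iha (b * c)
      exact ⟨z, hz, by rw [hza, smul_eq_mul]; ring, hzK⟩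
  have hmem : ∀ d k, k + d = r →
      ∀ x ∈ RingHom.ker (map (p := p) (Ideal.Quotient.mk (Ideal.span S))),
        truncate r (verschiebung^[k] x) ∈ K := by
    intro d
    induction d with
    | zero =>
      intro k hk x _
      obtain rfl : k = r := hk
      rw [truncate_iterate_verschiebung_self]
      exact zero_mem K
    | succ d ih =>
      intro k hkd x hx
      obtain ⟨z, hz, hz0, hzK⟩ := hlead k (by omega) _ (mem_ker_map_mk.mp hx 0) 1
      have hxz : x - z = verschiebung ((x - z).shift 1) :=
        eq_iterate_verschiebung (n := 1) fun i hi => by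
          obtain rfl : i = 0 := by omega
          change constantCoeff (x - z) = 0
          rw [map_sub, sub_eq_zero]
          exact (hz0.trans (mul_one _)).symm
      have hsub : truncate r (verschiebung^[k] (x - z)) ∈ K := by
        rw [hxz, ← Function.iterate_succ_apply]
        refine ih (k + 1) (by omega) _ (mem_ker_map_mk.mpr fun n => ?_)
        exact mem_ker_map_mk.mp (sub_mem hx hz) (1 + n)
      rw [← sub_add_cancel x z, iterate_map_add, map_add]
      exact add_mem hsub hzK
  intro x hx
  obtain ⟨y, hy, rfl⟩ := exists_truncate_eq_of_mem_wittIdeal hx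
  exact hmem r 0 (zero_add r) y hy

theorem truncate_iterate_verschiebung_teichmuller_mem {I : Ideal A} {f : A} (hf : f ∈ I)
    (N : ℕ) {k : ℕ} (hk : k ≤ r) (c : A) :
    truncate r (verschiebung^[k] (teichmuller p (f ^ (p ^ r * N) * c))) ∈ wittIdeal p r I ^ N := by
  obtain ⟨d, rfl⟩ := Nat.exists_eq_add_of_le hk
  have hpow : f ^ (p ^ (k + d) * N) = (f ^ (p ^ d * N)) ^ p ^ k := by
    rw [← pow_mul, pow_add]
    congr 1
    ring
  rw [hpow, mul_comm, map_mul, ← iterate_frobenius_teichmuller, ← iterate_verschiebung_mul_left,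
    map_mul, map_pow, map_pow]
  refine Ideal.mul_mem_left _ _ (Ideal.pow_le_pow_right ?_ (Ideal.pow_mem_pow
    (truncate_mem_wittIdeal (teichmuller_mem_ker_map_mk hf)) _))
  exact Nat.le_mul_of_pos_left N (pow_pos (Fact.out : p.Prime).pos d)

theorem wittIdeal_mono {I J : Ideal A} (h : I ≤ J) : wittIdeal p r I ≤ wittIdeal p r J := by
  intro x hx
  obtain ⟨y, hy, rfl⟩ := exists_truncate_eq_of_mem_wittIdeal hx
  exact truncate_mem_wittIdeal (mem_ker_map_mk.mpr fun n => h (mem_ker_map_mk.mp hy n))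

end

/-- **Statement 6.** Let `p` be a prime, `A` a commutative ring, `I ⊆ A` a finitely generated
ideal and `r ≥ 1`.  Then for every `N ≥ 1` there exists `M ≥ 1` such that
`W_r(I^M) ⊆ W_r(I)^N` as ideals of `W_r(A)`. -/
theorem statement6 (p r : ℕ) [Fact p.Prime] (hr : 1 ≤ r)
    (A : Type*) [CommRing A] (I : Ideal A) (hI : I.FG) :
    ∀ N : ℕ, 1 ≤ N → ∃ M : ℕ, 1 ≤ M ∧ wittIdeal p r (I ^ M) ≤ wittIdeal p r I ^ N := by
  intro N _
  set J : Ideal A := Ideal.span ((· ^ (p ^ r * N)) '' (I : Set A))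
  have hIJ : I ≤ J.radical := fun f hf => ⟨p ^ r * N, Ideal.subset_span ⟨f, hf, rfl⟩⟩
  obtain ⟨M, hM⟩ := Ideal.exists_pow_le_of_le_radical_of_fg hIJ hI
  refine ⟨M + 1, Nat.le_add_left 1 M,
    (wittIdeal_mono ((Ideal.pow_le_pow_right M.le_succ).trans hM)).trans (wittIdeal_span_le ?_)⟩
  rintro k hk _ ⟨f, hf, rfl⟩ c
  exact truncate_iterate_verschiebung_teichmuller_mem hf N hk.le c
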